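/- Let d ≥ 1, p,q ∈ (1,∞) and 0 < β ≤ d/p + 2/q. There is a constant N depending only on d, p, q, β such that for every u ∈ E^{1,2}_{p,q,β} and every ε ∈ (0,1]: ‖Du‖_{E_{p,q,β}} ≤ ε·(‖∂_t u‖_{E_{p,q,β}} + ‖D²u‖_{E_{p,q,β}}) + N·ε^{−1}·‖u‖_{E_{p,q,β}}. -/

import Mathlib

open MeasureTheory ENNReal NNReal Metric Set Filter Topology

noncomputable section

/-- Euclidean space `ℝ^d`. -/
abbrev Spc (d : ℕ) : Type := EuclideanSpace ℝ (Fin d)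

/-- Space-time `ℝ^{d+1} = ℝ × ℝ^d`, a point is `(t, x)`. -/
abbrev SpT (d : ℕ) : Type := ℝ × Spc d

/-- The parabolic cylinder `C_ρ(t₀,x₀) = [t₀, t₀+ρ²) × B_ρ(x₀)`. -/
def pCyl (d : ℕ) (ρ t₀ : ℝ) (x₀ : Spc d) : Set (SpT d) :=
  (Set.Ico t₀ (t₀ + ρ ^ 2)) ×ˢ (Metric.ball x₀ ρ)

/-- The (unnormalized) norm `‖f‖_{L_{p,q}(A)}
    = (∫_ℝ (∫_{ℝ^d} |f(t,x)|^p 1_A(t,x) dx)^{q/p} dt)^{1/q}`. -/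
def lpqNorm (d : ℕ) (p q : ℝ) (f : SpT d → ℝ) (A : Set (SpT d)) : ℝ≥0∞ :=
  (∫⁻ t : ℝ, (∫⁻ x : Spc d, A.indicator (fun z => ENNReal.ofReal |f z| ^ p) (t, x)) ^ (q / p)) ^ (1 / q)

/-- The normalized norm `⨍‖f‖_{L_{p,q}(C)}` over the cylinder `C_ρ(t₀,x₀)`:
    inner integral replaced by the average over the spatial ball, outer one
    by the average over the time interval. -/
def avgLpq (d : ℕ) (p q ρ t₀ : ℝ) (x₀ : Spc d) (f : SpT d → ℝ) : ℝ≥0∞ :=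
  ((∫⁻ t in Set.Ico t₀ (t₀ + ρ ^ 2),
      ((∫⁻ x in Metric.ball x₀ ρ, ENNReal.ofReal |f (t, x)| ^ p) / volume (Metric.ball x₀ ρ)) ^ (q / p))
      / ENNReal.ofReal (ρ ^ 2)) ^ (1 / q)

/-- The parabolic Morrey norm `‖f‖_{E_{p,q,β}}
    = sup { ρ^β ⨍‖f‖_{L_{p,q}(C)} : 0 < ρ ≤ 1, C ∈ ℂ_ρ }`. -/
def morreyNorm (d : ℕ) (p q β : ℝ) (f : SpT d → ℝ) : ℝ≥0∞ :=
  ⨆ (ρ : ℝ) (_ : 0 < ρ) (_ : ρ ≤ 1) (t₀ : ℝ) (x₀ : Spc d),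
    ENNReal.ofReal (ρ ^ β) * avgLpq d p q ρ t₀ x₀ f

/-- The homogeneous parabolic Morrey norm `‖f‖_{Ė_{p,q,β}}` (all radii `ρ > 0`). -/
def morreyNormH (d : ℕ) (p q β : ℝ) (f : SpT d → ℝ) : ℝ≥0∞ :=
  ⨆ (ρ : ℝ) (_ : 0 < ρ) (t₀ : ℝ) (x₀ : Spc d),
    ENNReal.ofReal (ρ ^ β) * avgLpq d p q ρ t₀ x₀ f

/-- Membership `f ∈ E_{p,q,β}`. -/
def MemE (d : ℕ) (p q β : ℝ) (f : SpT d → ℝ) : Prop :=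
  AEStronglyMeasurable f volume ∧ morreyNorm d p q β f ≠ ⊤

/-- Membership `f ∈ Ė_{p,q,β}` (homogeneous). -/
def MemEH (d : ℕ) (p q β : ℝ) (f : SpT d → ℝ) : Prop :=
  AEStronglyMeasurable f volume ∧ morreyNormH d p q β f ≠ ⊤

/-- The elliptic Morrey norm `‖f‖_{E_{p,β}(ℝ^d)}
    = sup { ρ^β (⨍_{B_ρ(x)} |f|^p)^{1/p} : 0 < ρ ≤ 1, x ∈ ℝ^d }`. -/
def morreyNormE (d : ℕ) (p β : ℝ) (f : Spc d → ℝ) : ℝ≥0∞ :=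
  ⨆ (ρ : ℝ) (_ : 0 < ρ) (_ : ρ ≤ 1) (x₀ : Spc d),
    ENNReal.ofReal (ρ ^ β) *
      ((∫⁻ y in Metric.ball x₀ ρ, ENNReal.ofReal |f y| ^ p) / volume (Metric.ball x₀ ρ)) ^ (1 / p)

/-- The homogeneous elliptic Morrey norm on `ℝ^d` (all radii `ρ > 0`). -/
def morreyNormEH (d : ℕ) (p β : ℝ) (f : Spc d → ℝ) : ℝ≥0∞ :=
  ⨆ (ρ : ℝ) (_ : 0 < ρ) (x₀ : Spc d),
    ENNReal.ofReal (ρ ^ β) *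
      ((∫⁻ y in Metric.ball x₀ ρ, ENNReal.ofReal |f y| ^ p) / volume (Metric.ball x₀ ρ)) ^ (1 / p)

/-- A mollifying kernel: nonnegative, smooth, compactly supported in
    `[-1,0) × B_1(0)`, with unit integral. -/
def IsMollifier (d : ℕ) (ζ : SpT d → ℝ) : Prop :=
  ContDiff ℝ (⊤ : ℕ∞) ζ ∧ (∀ z, 0 ≤ ζ z) ∧ (∫ z, ζ z) = 1 ∧
    Function.support ζ ⊆ (Set.Ico (-1 : ℝ) 0) ×ˢ (Metric.ball (0 : Spc d) 1)

/-- The mollification `f^{(ε)} = f * ζ_ε`, where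
    `ζ_ε(t,x) = ε^{-d-2} ζ(t/ε², x/ε)`. -/
def mollify (d : ℕ) (ζ : SpT d → ℝ) (ε : ℝ) (f : SpT d → ℝ) (z : SpT d) : ℝ :=
  ∫ w : SpT d, (ε ^ (-(d : ℝ) - 2) * ζ (w.1 / ε ^ 2, ε⁻¹ • w.2)) * f (z.1 - w.1, z.2 - w.2)

/-- The time direction in space-time. -/
def dirT (d : ℕ) : SpT d := (1, 0)

/-- The `i`-th spatial direction in space-time. -/
def dirS (d : ℕ) (i : Fin d) : SpT d := (0, EuclideanSpace.single i 1)

/-- `v` is the weak derivative of `u` in the direction `e`. -/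
def IsWeakDeriv (d : ℕ) (u v : SpT d → ℝ) (e : SpT d) : Prop :=
  ∀ φ : SpT d → ℝ, ContDiff ℝ (⊤ : ℕ∞) φ → HasCompactSupport φ →
    ∫ z, u z * fderiv ℝ φ z e = - ∫ z, v z * φ z

/-- `v` is the second weak derivative of `u` in the directions `e₁, e₂`. -/
def IsWeakDeriv2 (d : ℕ) (u v : SpT d → ℝ) (e₁ e₂ : SpT d) : Prop :=
  ∀ φ : SpT d → ℝ, ContDiff ℝ (⊤ : ℕ∞) φ → HasCompactSupport φ →
    ∫ z, u z * fderiv ℝ (fun w => fderiv ℝ φ w e₁) z e₂ = ∫ z, v z * φ z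

/-- The magnitude `|Du|` of the spatial gradient. -/
def gradMag (d : ℕ) (Du : Fin d → SpT d → ℝ) (z : SpT d) : ℝ :=
  Real.sqrt (∑ i, (Du i z) ^ 2)

/-- The magnitude `|D²u|` of the spatial Hessian. -/
def hessMag (d : ℕ) (D2u : Fin d → Fin d → SpT d → ℝ) (z : SpT d) : ℝ :=
  Real.sqrt (∑ i, ∑ j, (D2u i j z) ^ 2)

/-- `u ∈ E^{1,2}_{p,q,β}`, with weak spatial gradient `Du`, weak spatial Hessian
    `D2u`, and weak time derivative `ut`, all in `E_{p,q,β}`. -/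
def Mem12 (d : ℕ) (p q β : ℝ) (u : SpT d → ℝ) (Du : Fin d → SpT d → ℝ)
    (D2u : Fin d → Fin d → SpT d → ℝ) (ut : SpT d → ℝ) : Prop :=
  MemE d p q β u ∧ (∀ i, IsWeakDeriv d u (Du i) (dirS d i)) ∧
    (∀ i j, IsWeakDeriv2 d u (D2u i j) (dirS d i) (dirS d j)) ∧
    IsWeakDeriv d u ut (dirT d) ∧
    (∀ i, MemE d p q β (Du i)) ∧ (∀ i j, MemE d p q β (D2u i j)) ∧ MemE d p q β ut

/-- `u ∈ Ė^{1,2}_{p,q,β}` (homogeneous version). -/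
def Mem12H (d : ℕ) (p q β : ℝ) (u : SpT d → ℝ) (Du : Fin d → SpT d → ℝ)
    (D2u : Fin d → Fin d → SpT d → ℝ) (ut : SpT d → ℝ) : Prop :=
  MemEH d p q β u ∧ (∀ i, IsWeakDeriv d u (Du i) (dirS d i)) ∧
    (∀ i j, IsWeakDeriv2 d u (D2u i j) (dirS d i) (dirS d j)) ∧
    IsWeakDeriv d u ut (dirT d) ∧
    (∀ i, MemEH d p q β (Du i)) ∧ (∀ i j, MemEH d p q β (D2u i j)) ∧ MemEH d p q β ut

/-- The norm `‖u‖_{E^{1,2}_{p,q,β}} = ‖u‖ + ‖Du‖ + ‖D²u‖ + ‖∂ₜu‖`. -/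
def norm12 (d : ℕ) (p q β : ℝ) (u : SpT d → ℝ) (Du : Fin d → SpT d → ℝ)
    (D2u : Fin d → Fin d → SpT d → ℝ) (ut : SpT d → ℝ) : ℝ≥0∞ :=
  morreyNorm d p q β u + morreyNorm d p q β (gradMag d Du)
    + morreyNorm d p q β (hessMag d D2u) + morreyNorm d p q β ut

/-- Membership `f ∈ L_{p,q}(ℝ^{d+1})`. -/
def MemLpq (d : ℕ) (p q : ℝ) (f : SpT d → ℝ) : Prop :=
  AEStronglyMeasurable f volume ∧ lpqNorm d p q f Set.univ ≠ ⊤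

/-- `u ∈ W^{1,2}_{p,q}(ℝ^{d+1})`: `u`, its weak spatial gradient `Du`,
    weak spatial Hessian `D2u` and weak time derivative `ut` are in `L_{p,q}`. -/
def MemW12 (d : ℕ) (p q : ℝ) (u : SpT d → ℝ) (Du : Fin d → SpT d → ℝ)
    (D2u : Fin d → Fin d → SpT d → ℝ) (ut : SpT d → ℝ) : Prop :=
  MemLpq d p q u ∧ (∀ i, IsWeakDeriv d u (Du i) (dirS d i)) ∧
    (∀ i j, IsWeakDeriv2 d u (D2u i j) (dirS d i) (dirS d j)) ∧
    IsWeakDeriv d u ut (dirT d) ∧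
    (∀ i, MemLpq d p q (Du i)) ∧ (∀ i j, MemLpq d p q (D2u i j)) ∧ MemLpq d p q ut

/-- Convergence `F ε → v` in `L_r(B)` as `ε ↓ 0`. -/
def TendstoLr (d : ℕ) (r : ℝ) (B : Set (Spc d)) (F : ℝ → Spc d → ℝ) (v : Spc d → ℝ) : Prop :=
  Tendsto (fun ε => (∫⁻ x in B, ENNReal.ofReal |F ε x - v x| ^ r) ^ (1 / r))
    (𝓝[>] (0 : ℝ)) (𝓝 0)

section Minkowski

variable {S T X : Type*} [MeasurableSpace S] [MeasurableSpace T] [MeasurableSpace X]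

/-- Minkowski's integral inequality, for the truncation at height `n` of the integrated function. -/
lemma lintegral_min_rpow_le (κ : Measure S) [SFinite κ] (μ : Measure X) [IsFiniteMeasure μ]
    {p : ℝ} (hp : 1 < p) {F : S → X → ℝ≥0∞} (hF : Measurable (Function.uncurry F)) (n : ℕ) :
    ∫⁻ x, (min (∫⁻ s, F s x ∂κ) n) ^ p ∂μ ≤
      (∫⁻ s, (∫⁻ x, F s x ^ p ∂μ) ^ (1 / p) ∂κ) ^ p := by
  set G : X → ℝ≥0∞ := fun x => min (∫⁻ s, F s x ∂κ) n
  set I := ∫⁻ x, G x ^ p ∂μ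
  set M := ∫⁻ s, (∫⁻ x, F s x ^ p ∂μ) ^ (1 / p) ∂κ
  have hp0 : 0 < p := one_pos.trans hp
  have hpq := Real.HolderConjugate.conjExponent hp
  set r := p.conjExponent
  have hGm : Measurable G := (hF.lintegral_prod_left').min measurable_const
  have hI_top : I ≠ ⊤ := by
    refine ne_top_of_le_ne_top (b := ∫⁻ _, (n : ℝ≥0∞) ^ p ∂μ) ?_
      (lintegral_mono fun x => by gcongr; exact min_le_right _ _)
    rw [lintegral_const]
    exact ENNReal.mul_ne_top (ENNReal.rpow_ne_top_of_nonneg hp0.le (ENNReal.natCast_ne_top n))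
      (measure_ne_top _ _)
  have key : I ≤ M * I ^ (1 / r) := by
    calc I ≤ ∫⁻ x, ∫⁻ s, F s x * G x ^ (p - 1) ∂κ ∂μ := by
          refine lintegral_mono fun x => ?_
          simp only
          rw [lintegral_mul_const _ hF.of_uncurry_right]
          calc G x ^ p = G x ^ (1 + (p - 1)) := by ring_nf
            _ = G x * G x ^ (p - 1) := by
              rw [ENNReal.rpow_add_of_nonneg _ _ zero_le_one (by linarith), ENNReal.rpow_one]
            _ ≤ _ := by gcongr; exact min_le_left _ _
      _ = ∫⁻ s, ∫⁻ x, F s x * G x ^ (p - 1) ∂μ ∂κ := by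
          rw [lintegral_lintegral_swap]
          exact ((hF.comp measurable_swap).mul
            ((hGm.pow_const _).comp measurable_fst)).aemeasurable
      _ ≤ ∫⁻ s, (∫⁻ x, F s x ^ p ∂μ) ^ (1 / p) * I ^ (1 / r) ∂κ := by
          refine lintegral_mono fun s => ?_
          refine (ENNReal.lintegral_mul_le_Lp_mul_Lq μ hpq
            (hF.comp measurable_prodMk_left).aemeasurable
            (hGm.pow_const _).aemeasurable).trans_eq ?_
          simp only [← ENNReal.rpow_mul, hpq.sub_one_mul_conj]
          rfl
      _ = M * I ^ (1 / r) := by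
          rw [lintegral_mul_const]
          exact ((hF.pow_const p).lintegral_prod_right').pow_const _
  rcases eq_or_ne I 0 with h0 | h0
  · rw [h0]; exact zero_le
  have hIr0 : I ^ (1 / r) ≠ 0 := by simp [ENNReal.rpow_eq_zero_iff, h0, hI_top]
  have hIrt : I ^ (1 / r) ≠ ⊤ := ENNReal.rpow_ne_top_of_nonneg (by
    have := hpq.symm.pos; positivity) hI_top
  have hsplit : I = I ^ (1 / p) * I ^ (1 / r) := by
    rw [← ENNReal.rpow_add _ _ h0 hI_top, one_div, one_div, hpq.inv_add_inv_eq_one,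
      ENNReal.rpow_one]
  have : I ^ (1 / p) ≤ M := by
    nth_rw 1 [hsplit] at key
    exact (ENNReal.mul_le_mul_iff_left hIr0 hIrt).1 key
  calc I = (I ^ (1 / p)) ^ p := by
        rw [← ENNReal.rpow_mul, one_div, inv_mul_cancel₀ hp0.ne', ENNReal.rpow_one]
    _ ≤ M ^ p := by gcongr

/-- Minkowski's integral inequality. -/
lemma rpow_lintegral_lintegral_le (κ : Measure S) [SFinite κ] (μ : Measure X) [IsFiniteMeasure μ]
    {p : ℝ} (hp : 1 < p) {F : S → X → ℝ≥0∞} (hF : Measurable (Function.uncurry F)) :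
    (∫⁻ x, (∫⁻ s, F s x ∂κ) ^ p ∂μ) ^ (1 / p) ≤
      ∫⁻ s, (∫⁻ x, F s x ^ p ∂μ) ^ (1 / p) ∂κ := by
  have hp0 : 0 < p := one_pos.trans hp
  have hGm : Measurable fun x => ∫⁻ s, F s x ∂κ := hF.lintegral_prod_left'
  rw [one_div, ENNReal.rpow_inv_le_iff hp0]
  have hsup : ∀ x, (∫⁻ s, F s x ∂κ) ^ p = ⨆ n : ℕ, (min (∫⁻ s, F s x ∂κ) n) ^ p := by
    intro x
    have h1 : (∫⁻ s, F s x ∂κ) = ⨆ n : ℕ, min (∫⁻ s, F s x ∂κ) n := by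
      have := inf_iSup_eq (∫⁻ s, F s x ∂κ) (fun n : ℕ => (n : ℝ≥0∞))
      rw [ENNReal.iSup_natCast, inf_top_eq] at this
      exact this
    conv_lhs => rw [h1]
    exact (ENNReal.orderIsoRpow p hp0).map_iSup _
  simp_rw [hsup]
  rw [lintegral_iSup (fun n => (hGm.min measurable_const).pow_const p)]
  · refine iSup_le fun n => ?_
    have := lintegral_min_rpow_le κ μ hp hF n
    rwa [one_div] at this
  · intro m n hmn x
    simp only
    gcongr

/-- The mixed `L_{p,q}` norm with respect to a pair of measures. -/
def mixedNorm (ν : Measure T) (μ : Measure X) (p q : ℝ) (G : T × X → ℝ≥0∞) : ℝ≥0∞ :=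
  (∫⁻ t, (∫⁻ x, G (t, x) ^ p ∂μ) ^ (q / p) ∂ν) ^ (1 / q)

lemma mixedNorm_eq (ν : Measure T) (μ : Measure X) (p q : ℝ) (G : T × X → ℝ≥0∞) :
    mixedNorm ν μ p q G =
      (∫⁻ t, ((∫⁻ x, G (t, x) ^ p ∂μ) ^ (1 / p)) ^ q ∂ν) ^ (1 / q) := by
  simp only [mixedNorm, ← ENNReal.rpow_mul, one_div_mul_eq_div]

lemma mixedNorm_mono {ν : Measure T} {μ : Measure X} [SFinite μ] {p q : ℝ} (hp : 0 < p)
    (hq : 0 < q) {F G : T × X → ℝ≥0∞} (h : F ≤ᵐ[ν.prod μ] G) :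
    mixedNorm ν μ p q F ≤ mixedNorm ν μ p q G := by
  refine ENNReal.rpow_le_rpow (lintegral_mono_ae ?_) (by positivity)
  filter_upwards [Measure.ae_ae_of_ae_prod h] with t ht
  refine ENNReal.rpow_le_rpow (lintegral_mono_ae ?_) (by positivity)
  filter_upwards [ht] with x hx
  gcongr

lemma mixedNorm_lintegral_le (κ : Measure S) [SFinite κ] (ν : Measure T) [IsFiniteMeasure ν]
    (μ : Measure X) [IsFiniteMeasure μ] {p q : ℝ} (hp : 1 < p) (hq : 1 < q)
    {F : S → T × X → ℝ≥0∞} (hF : Measurable (Function.uncurry F)) :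
    mixedNorm ν μ p q (fun z => ∫⁻ s, F s z ∂κ) ≤ ∫⁻ s, mixedNorm ν μ p q (F s) ∂κ := by
  simp only [mixedNorm_eq]
  have hm : Measurable fun y : (S × T) × X => F y.1.1 (y.1.2, y.2) :=
    hF.comp (f := fun y : (S × T) × X => (y.1.1, (y.1.2, y.2))) (by fun_prop)
  have hH : Measurable (Function.uncurry fun (s : S) (t : T) =>
      (∫⁻ x, F s (t, x) ^ p ∂μ) ^ (1 / p)) :=
    ((hm.pow_const p).lintegral_prod_right').pow_const _
  refine le_trans ?_ (rpow_lintegral_lintegral_le κ ν hq hH)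
  have hq0 : 0 < q := one_pos.trans hq
  refine ENNReal.rpow_le_rpow (lintegral_mono fun t => ?_) (by positivity)
  refine ENNReal.rpow_le_rpow ?_ hq0.le
  exact rpow_lintegral_lintegral_le κ μ hp
    (hF.comp (f := fun y : S × X => (y.1, (t, y.2))) (by fun_prop))

lemma lintegral_le_rpow_mul {μ : Measure X} {p : ℝ} (hp : 1 < p) {f : X → ℝ≥0∞}
    (hf : AEMeasurable f μ) :
    ∫⁻ x, f x ∂μ ≤ (∫⁻ x, f x ^ p ∂μ) ^ (1 / p) * μ univ ^ (1 / p.conjExponent) := by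
  simpa using ENNReal.lintegral_mul_le_Lp_mul_Lq μ (Real.HolderConjugate.conjExponent hp) hf
    (g := fun _ => 1) aemeasurable_const

lemma lintegral_prod_lt_top_of_mixedNorm {ν : Measure T} [IsFiniteMeasure ν] {μ : Measure X}
    [IsFiniteMeasure μ] {p q : ℝ} (hp : 1 < p) (hq : 1 < q) {G : T × X → ℝ≥0∞}
    (hG : Measurable G) (h : mixedNorm ν μ p q G ≠ ⊤) : ∫⁻ z, G z ∂(ν.prod μ) < ⊤ := by
  rw [mixedNorm_eq] at h
  rw [lintegral_prod _ hG.aemeasurable]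
  have hfin : ∀ {r : ℝ} (c : ℝ≥0∞), 1 < r → c ≠ ⊤ → c ^ (1 / r.conjExponent) ≠ ⊤ :=
    fun c hr hc => ENNReal.rpow_ne_top_of_nonneg
      (one_div_nonneg.2 (Real.HolderConjugate.conjExponent hr).symm.nonneg) hc
  calc ∫⁻ t, ∫⁻ x, G (t, x) ∂μ ∂ν
      ≤ ∫⁻ t, (∫⁻ x, G (t, x) ^ p ∂μ) ^ (1 / p) * μ univ ^ (1 / p.conjExponent) ∂ν :=
        lintegral_mono fun t =>
          lintegral_le_rpow_mul hp (hG.comp measurable_prodMk_left).aemeasurable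
    _ = (∫⁻ t, (∫⁻ x, G (t, x) ^ p ∂μ) ^ (1 / p) ∂ν) * μ univ ^ (1 / p.conjExponent) :=
        lintegral_mul_const _ (((hG.pow_const p).lintegral_prod_right').pow_const _)
    _ ≤ ((∫⁻ t, ((∫⁻ x, G (t, x) ^ p ∂μ) ^ (1 / p)) ^ q ∂ν) ^ (1 / q) *
          ν univ ^ (1 / q.conjExponent)) * μ univ ^ (1 / p.conjExponent) := by
        gcongr
        exact lintegral_le_rpow_mul hq
          (((hG.pow_const p).lintegral_prod_right').pow_const _).aemeasurable
    _ < ⊤ := (ENNReal.mul_ne_top (ENNReal.mul_ne_top h (hfin _ hq (measure_ne_top _ _)))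
      (hfin _ hp (measure_ne_top _ _))).lt_top

end Minkowski

section Morrey

variable {d : ℕ} {p q β : ℝ}

/-- Normalized Lebesgue measure on a spatial ball. -/
def avgBall (x₀ : Spc d) (ρ : ℝ) : Measure (Spc d) :=
  (volume (Metric.ball x₀ ρ))⁻¹ • volume.restrict (Metric.ball x₀ ρ)

/-- Normalized Lebesgue measure on a time interval. -/
def avgIco (t₀ ρ : ℝ) : Measure ℝ :=
  (ENNReal.ofReal (ρ ^ 2))⁻¹ • volume.restrict (Set.Ico t₀ (t₀ + ρ ^ 2))

lemma isFiniteMeasure_avgBall (x₀ : Spc d) {ρ : ℝ} (hρ : 0 < ρ) :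
    IsFiniteMeasure (avgBall x₀ ρ) :=
  have : IsFiniteMeasure (volume.restrict (Metric.ball x₀ ρ)) :=
    ⟨by simpa using measure_ball_lt_top⟩
  Measure.smul_finite _ (ENNReal.inv_ne_top.2 (Metric.measure_ball_pos _ _ hρ).ne')

lemma isFiniteMeasure_avgIco (t₀ : ℝ) {ρ : ℝ} (hρ : 0 < ρ) : IsFiniteMeasure (avgIco t₀ ρ) :=
  Measure.smul_finite _ (ENNReal.inv_ne_top.2 (by simpa using hρ.ne'))

lemma avgIco_prod_avgBall (t₀ : ℝ) (x₀ : Spc d) (ρ : ℝ) :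
    (avgIco t₀ ρ).prod (avgBall x₀ ρ) =
      ((ENNReal.ofReal (ρ ^ 2))⁻¹ * (volume (Metric.ball x₀ ρ))⁻¹) •
        volume.restrict (Set.Ico t₀ (t₀ + ρ ^ 2) ×ˢ Metric.ball x₀ ρ) := by
  rw [Measure.volume_eq_prod, ← Measure.prod_restrict, avgIco, avgBall,
    Measure.prod_smul_left, Measure.prod_smul_right, smul_smul]

lemma avgLpq_eq (ρ t₀ : ℝ) (x₀ : Spc d) (f : SpT d → ℝ) :
    avgLpq d p q ρ t₀ x₀ f =
      mixedNorm (avgIco t₀ ρ) (avgBall x₀ ρ) p q (fun z => ENNReal.ofReal |f z|) := by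
  simp only [avgLpq, mixedNorm, avgIco, avgBall, lintegral_smul_measure, smul_eq_mul,
    ENNReal.div_eq_inv_mul]

/-- The parabolic Morrey norm of a function with values in `[0, ∞]`. -/
def morreyNormENN (d : ℕ) (p q β : ℝ) (G : SpT d → ℝ≥0∞) : ℝ≥0∞ :=
  ⨆ (ρ : ℝ) (_ : 0 < ρ) (_ : ρ ≤ 1) (t₀ : ℝ) (x₀ : Spc d),
    ENNReal.ofReal (ρ ^ β) * mixedNorm (avgIco t₀ ρ) (avgBall x₀ ρ) p q G

lemma morreyNorm_eq (f : SpT d → ℝ) :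
    morreyNorm d p q β f = morreyNormENN d p q β (fun z => ENNReal.ofReal |f z|) := by
  simp only [morreyNorm, morreyNormENN, avgLpq_eq]

lemma le_morreyNormENN {ρ : ℝ} (h0 : 0 < ρ) (h1 : ρ ≤ 1) (t₀ : ℝ) (x₀ : Spc d)
    (G : SpT d → ℝ≥0∞) :
    ENNReal.ofReal (ρ ^ β) * mixedNorm (avgIco t₀ ρ) (avgBall x₀ ρ) p q G ≤
      morreyNormENN d p q β G :=
  le_iSup_of_le ρ <| le_iSup_of_le h0 <| le_iSup_of_le h1 <| le_iSup_of_le t₀ <|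
    le_iSup_of_le x₀ le_rfl

lemma morreyNormENN_mono (hp : 0 < p) (hq : 0 < q) {F G : SpT d → ℝ≥0∞}
    (h : F ≤ᵐ[volume] G) : morreyNormENN d p q β F ≤ morreyNormENN d p q β G := by
  refine iSup_le fun ρ => iSup_le fun h0 => iSup_le fun h1 => iSup_le fun t₀ => iSup_le fun x₀ => ?_
  refine le_trans ?_ (le_morreyNormENN h0 h1 t₀ x₀ G)
  have := isFiniteMeasure_avgBall x₀ h0
  gcongr
  refine mixedNorm_mono hp hq ?_
  rw [avgIco_prod_avgBall t₀ x₀ ρ]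
  exact Measure.ae_smul_measure (ae_restrict_of_ae h) _

lemma morreyNorm_congr (hp : 0 < p) (hq : 0 < q) {f g : SpT d → ℝ} (h : f =ᵐ[volume] g) :
    morreyNorm d p q β f = morreyNorm d p q β g := by
  simp only [morreyNorm_eq]
  apply le_antisymm <;> refine morreyNormENN_mono hp hq ?_ <;>
    filter_upwards [h] with z hz <;> rw [hz]

lemma morreyNormENN_lintegral_le {S : Type*} [MeasurableSpace S] (κ : Measure S) [SFinite κ]
    (hp : 1 < p) (hq : 1 < q) {F : S → SpT d → ℝ≥0∞} (hF : Measurable (Function.uncurry F)) :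
    morreyNormENN d p q β (fun z => ∫⁻ s, F s z ∂κ) ≤
      ∫⁻ s, morreyNormENN d p q β (F s) ∂κ := by
  refine iSup_le fun ρ => iSup_le fun h0 => iSup_le fun h1 => iSup_le fun t₀ => iSup_le fun x₀ => ?_
  have := isFiniteMeasure_avgBall x₀ h0
  have := isFiniteMeasure_avgIco t₀ h0
  calc _ ≤ ENNReal.ofReal (ρ ^ β) *
        ∫⁻ s, mixedNorm (avgIco t₀ ρ) (avgBall x₀ ρ) p q (F s) ∂κ := by
        gcongr
        exact mixedNorm_lintegral_le κ _ _ hp hq hF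
    _ = ∫⁻ s, ENNReal.ofReal (ρ ^ β) *
          mixedNorm (avgIco t₀ ρ) (avgBall x₀ ρ) p q (F s) ∂κ :=
        (lintegral_const_mul' _ _ ENNReal.ofReal_ne_top).symm
    _ ≤ _ := lintegral_mono fun s => le_morreyNormENN h0 h1 t₀ x₀ _

lemma morreyNormENN_sum_le {ι : Type*} [Fintype ι] (hp : 1 < p) (hq : 1 < q)
    {F : ι → SpT d → ℝ≥0∞} (hF : ∀ i, Measurable (F i)) :
    morreyNormENN d p q β (fun z => ∑ i, F i z) ≤ ∑ i, morreyNormENN d p q β (F i) := by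
  let : MeasurableSpace ι := ⊤
  have : MeasurableSingletonClass ι := ⟨fun _ => trivial⟩
  simpa [lintegral_count, tsum_fintype] using
    morreyNormENN_lintegral_le (β := β) (Measure.count : Measure ι) hp hq
      (measurable_from_prod_countable_right hF)

lemma morreyNormENN_add_le (hp : 1 < p) (hq : 1 < q) {F G : SpT d → ℝ≥0∞} (hF : Measurable F)
    (hG : Measurable G) :
    morreyNormENN d p q β (fun z => F z + G z) ≤
      morreyNormENN d p q β F + morreyNormENN d p q β G := by
  simpa using morreyNormENN_sum_le (β := β) hp hq (F := fun b : Bool => cond b F G)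
    (fun b => by cases b <;> assumption)

lemma morreyNormENN_const_mul_le (hp : 1 < p) (hq : 1 < q) (c : ℝ≥0∞) {F : SpT d → ℝ≥0∞}
    (hF : Measurable F) :
    morreyNormENN d p q β (fun z => c * F z) ≤ c * morreyNormENN d p q β F := by
  simpa [mul_comm c] using morreyNormENN_lintegral_le (β := β) (c • Measure.dirac ()) hp hq
    (F := fun _ : Unit => F) (hF.comp measurable_snd)

lemma lintegral_avgBall_add (x₀ y : Spc d) (ρ : ℝ) (g : Spc d → ℝ≥0∞) :
    ∫⁻ x, g (x + y) ∂(avgBall x₀ ρ) = ∫⁻ x, g x ∂(avgBall (x₀ + y) ρ) := by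
  have hpre : (fun x : Spc d => x + y) ⁻¹' Metric.ball (x₀ + y) ρ = Metric.ball x₀ ρ := by
    ext x
    simp
  have hint := (measurePreserving_add_right (volume : Measure (Spc d)) y).setLIntegral_comp_preimage_emb
    (measurableEmbedding_addRight y) g (Metric.ball (x₀ + y) ρ)
  rw [hpre] at hint
  rw [avgBall, avgBall, lintegral_smul_measure, lintegral_smul_measure, hint,
    Measure.addHaar_ball_center volume x₀, Measure.addHaar_ball_center volume (x₀ + y)]

lemma morreyNormENN_translate_le (y : Spc d) (G : SpT d → ℝ≥0∞) :
    morreyNormENN d p q β (fun z => G (z + (0, y))) ≤ morreyNormENN d p q β G := by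
  refine iSup_le fun ρ => iSup_le fun h0 => iSup_le fun h1 => iSup_le fun t₀ => iSup_le fun x₀ => ?_
  refine le_trans (le_of_eq ?_) (le_morreyNormENN h0 h1 t₀ (x₀ + y) G)
  simp only [mixedNorm, Prod.mk_add_mk, add_zero]
  congr 3
  ext t
  rw [lintegral_avgBall_add x₀ y ρ (fun x => G (t, x) ^ p)]

lemma setLIntegral_lt_top_of_morreyNormENN (hp : 1 < p) (hq : 1 < q) {G : SpT d → ℝ≥0∞}
    (hG : Measurable G) (h : morreyNormENN d p q β G ≠ ⊤) (z : SpT d) :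
    ∃ U ∈ 𝓝 z, ∫⁻ w in U, G w < ⊤ := by
  refine ⟨Set.Ico (z.1 - 1 / 2) (z.1 - 1 / 2 + 1 ^ 2) ×ˢ Metric.ball z.2 1,
    prod_mem_nhds (Ico_mem_nhds (by linarith) (by linarith)) (Metric.ball_mem_nhds _ one_pos), ?_⟩
  have := isFiniteMeasure_avgBall z.2 one_pos
  have := isFiniteMeasure_avgIco (z.1 - 1 / 2) one_pos
  have h1 : mixedNorm (avgIco (z.1 - 1 / 2) 1) (avgBall z.2 1) p q G ≠ ⊤ := by
    refine ne_top_of_le_ne_top h (le_trans ?_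
      (le_morreyNormENN one_pos le_rfl (z.1 - 1 / 2) z.2 G))
    simp
  have h2 := lintegral_prod_lt_top_of_mixedNorm hp hq hG h1
  rw [avgIco_prod_avgBall, lintegral_smul_measure, smul_eq_mul] at h2
  refine (ENNReal.lt_top_of_mul_ne_top_right h2.ne ?_)
  refine mul_ne_zero (ENNReal.inv_ne_zero.2 ENNReal.ofReal_ne_top)
    (ENNReal.inv_ne_zero.2 measure_ball_lt_top.ne)

lemma locallyIntegrable_of_morreyNorm (hp : 1 < p) (hq : 1 < q) {f : SpT d → ℝ}
    (hf : AEStronglyMeasurable f volume) (h : morreyNorm d p q β f ≠ ⊤) :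
    LocallyIntegrable f volume := by
  intro z
  have hm : Measurable fun z => ENNReal.ofReal |hf.mk f z| :=
    (hf.stronglyMeasurable_mk.measurable.abs).ennreal_ofReal
  rw [morreyNorm_congr (one_pos.trans hp) (one_pos.trans hq) hf.ae_eq_mk, morreyNorm_eq] at h
  obtain ⟨U, hU, hlt⟩ := setLIntegral_lt_top_of_morreyNormENN hp hq hm h z
  refine ⟨U, hU, hf.restrict, ?_⟩
  rw [hasFiniteIntegral_iff_norm]
  refine lt_of_le_of_lt (le_of_eq (lintegral_congr_ae ?_)) hlt
  filter_upwards [ae_restrict_of_ae hf.ae_eq_mk] with w hw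
  rw [hw, Real.norm_eq_abs]

end Morrey

section Taylor

variable {E : Type*} [NormedAddCommGroup E] [NormedSpace ℝ E]

lemma fderiv_comp_sub_const {F : Type*} [NormedAddCommGroup F] [NormedSpace ℝ F] (f : E → F)
    (a z : E) : fderiv ℝ (fun w => f (w - a)) z = fderiv ℝ f (z - a) := by
  simpa only [sub_eq_add_neg] using fderiv_comp_add_right (f := f) (x := z) (-a)

/-- Second order Taylor expansion with integral remainder along a segment. -/
lemma integral_one_sub_mul_fderiv_fderiv {φ : E → ℝ} (hφ : ContDiff ℝ (⊤ : ℕ∞) φ) (y z : E) :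
    ∫ s in (0 : ℝ)..1, (1 - s) * fderiv ℝ (fun w => fderiv ℝ φ w y) (z - s • y) y =
      φ (z - y) - φ z + fderiv ℝ φ z y := by
  have hD : ContDiff ℝ (⊤ : ℕ∞) (fun w => fderiv ℝ φ w y) :=
    (hφ.fderiv_right (m := (⊤ : ℕ∞)) (by simp)).clm_apply contDiff_const
  have hD2 : ContDiff ℝ (⊤ : ℕ∞) (fun w => fderiv ℝ (fun w => fderiv ℝ φ w y) w y) :=
    (hD.fderiv_right (m := (⊤ : ℕ∞)) (by simp)).clm_apply contDiff_const
  have hline : ∀ s : ℝ, HasDerivAt (fun s : ℝ => z - s • y) (-y) s := fun s => by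
    simpa using ((hasDerivAt_id s).smul_const y).const_sub z
  have h1 : ∀ s : ℝ, HasDerivAt (fun s : ℝ => φ (z - s • y)) (-fderiv ℝ φ (z - s • y) y) s :=
    fun s => by
      simpa [Function.comp_def] using
        ((hφ.differentiable (by simp)) (z - s • y)).hasFDerivAt.comp_hasDerivAt s (hline s)
  have h2 : ∀ s : ℝ, HasDerivAt (fun s : ℝ => fderiv ℝ φ (z - s • y) y)
      (-fderiv ℝ (fun w => fderiv ℝ φ w y) (z - s • y) y) s := fun s => by
    simpa [Function.comp_def] using
      ((hD.differentiable (by simp)) (z - s • y)).hasFDerivAt.comp_hasDerivAt s (hline s)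
  have h3 : ∀ s : ℝ, HasDerivAt (fun s : ℝ => φ (z - s • y) - (1 - s) * fderiv ℝ φ (z - s • y) y)
      ((1 - s) * fderiv ℝ (fun w => fderiv ℝ φ w y) (z - s • y) y) s := fun s => by
    refine ((h1 s).sub (((hasDerivAt_id s).const_sub 1).mul (h2 s))).congr_deriv ?_
    simp only [id]
    ring
  rw [intervalIntegral.integral_eq_sub_of_hasDerivAt (fun s _ => h3 s)
    (Continuous.intervalIntegrable ((continuous_const.sub continuous_id).mul
      (hD2.continuous.comp (by fun_prop))) _ _)]
  simp only [one_smul, zero_smul, sub_self, sub_zero, zero_mul, one_mul]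
  ring

end Taylor

section Translates

variable {E : Type*} [NormedAddCommGroup E] [NormedSpace ℝ E] [MeasurableSpace E] [BorelSpace E]
  [SecondCountableTopology E] {μ : Measure E}

lemma integrable_prod_one_sub_mul_translate {f ψ : E → ℝ} (hfm : Measurable f)
    (hf : LocallyIntegrable f μ) (hψ : Continuous ψ) (hψc : HasCompactSupport ψ) (y : E) :
    Integrable (fun a : ℝ × E => (1 - a.1) * (f a.2 * ψ (a.2 - a.1 • y)))
      ((volume.restrict (Set.Ioc 0 1)).prod μ) := by
  obtain ⟨C, hC⟩ := hψ.bounded_above_of_compact_support hψc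
  set K : Set E := (fun a : ℝ × E => a.2 + a.1 • y) '' (Set.Icc 0 1 ×ˢ tsupport ψ)
  have hKc : IsCompact K := (isCompact_Icc.prod hψc).image (by fun_prop)
  have hint : Integrable (K.indicator f) μ :=
    (integrable_indicator_iff hKc.measurableSet).2 (hf.integrableOn_isCompact hKc)
  refine (Integrable.mul_prod (integrable_const C) hint.norm).mono' ?_ ?_
  · exact Measurable.aestronglyMeasurable (((measurable_const.sub measurable_fst)).mul
      ((hfm.comp measurable_snd).mul (hψ.measurable.comp (by fun_prop))))
  · filter_upwards [Measure.quasiMeasurePreserving_fst.ae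
      (ae_restrict_mem (μ := volume) (measurableSet_Ioc (a := (0 : ℝ)) (b := 1)))] with a ha
    have hs : |1 - a.1| ≤ 1 := abs_le.2 ⟨by linarith [ha.2], by linarith [ha.1]⟩
    by_cases hz : a.2 ∈ K
    · rw [Set.indicator_of_mem hz, norm_mul, norm_mul, Real.norm_eq_abs (1 - a.1)]
      calc |1 - a.1| * (‖f a.2‖ * ‖ψ (a.2 - a.1 • y)‖) ≤ 1 * (‖f a.2‖ * C) := by
            gcongr
            exact hC _
        _ = _ := by ring
    · have : ψ (a.2 - a.1 • y) = 0 := by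
        by_contra h
        exact hz ⟨(a.1, a.2 - a.1 • y), ⟨⟨ha.1.le, ha.2⟩, subset_tsupport _ h⟩, by simp⟩
      simp [this, hz]

lemma integral_one_sub_mul_integral_translate [SFinite μ] {f ψ : E → ℝ} (hfm : Measurable f)
    (hf : LocallyIntegrable f μ) (hψ : Continuous ψ) (hψc : HasCompactSupport ψ) (y : E) :
    ∫ s in (0 : ℝ)..1, (1 - s) * ∫ z, f z * ψ (z - s • y) ∂μ =
      ∫ z, f z * (∫ s in (0 : ℝ)..1, (1 - s) * ψ (z - s • y)) ∂μ := by
  have := integral_integral_swap (f := fun (s : ℝ) z => (1 - s) * (f z * ψ (z - s • y)))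
    (integrable_prod_one_sub_mul_translate hfm hf hψ hψc y)
  simp only [intervalIntegral.integral_of_le zero_le_one, ← integral_const_mul]
  rw [this]
  refine integral_congr_ae (ae_of_all _ fun z => integral_congr_ae (ae_of_all _ fun s => ?_))
  simp only
  ring

lemma integral_translate_average_mul [SFinite μ] [μ.IsAddRightInvariant]
    {f ψ : E → ℝ} (hfm : Measurable f)
    (hf : LocallyIntegrable f μ) (hψ : Continuous ψ) (hψc : HasCompactSupport ψ) (y : E) :
    ∫ z, (∫ s in (0 : ℝ)..1, (1 - s) * f (z + s • y)) * ψ z ∂μ =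
      ∫ s in (0 : ℝ)..1, (1 - s) * ∫ z, f z * ψ (z - s • y) ∂μ := by
  have hmp : MeasurePreserving (fun a : ℝ × E => (a.1, a.2 + a.1 • y))
      ((volume.restrict (Set.Ioc (0 : ℝ) 1)).prod μ)
      ((volume.restrict (Set.Ioc (0 : ℝ) 1)).prod μ) :=
    (MeasurePreserving.id _).skew_product (g := fun (s : ℝ) z => z + s • y) (by fun_prop)
      (ae_of_all _ fun s => map_add_right_eq_self μ (s • y))
  have hint := hmp.integrable_comp_of_integrable
    (integrable_prod_one_sub_mul_translate hfm hf hψ hψc y)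
  have := integral_integral_swap (f := fun (s : ℝ) z => (1 - s) * (f (z + s • y) * ψ z))
    (hint.congr (ae_of_all _ fun a => by simp [Function.uncurry]))
  simp only [intervalIntegral.integral_of_le zero_le_one, ← integral_mul_const]
  simp only [mul_assoc]
  rw [← this]
  refine integral_congr_ae (ae_of_all _ fun s => ?_)
  simp only [integral_const_mul]
  congr 1
  rw [← integral_add_right_eq_self (fun z => f z * ψ (z - s • y)) (s • y)]
  simp

end Translates

section WeakDerivatives

variable {d : ℕ}

lemma IsWeakDeriv.congr {u u' v : SpT d → ℝ} {e : SpT d} (h : IsWeakDeriv d u v e)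
    (hu : u =ᵐ[volume] u') : IsWeakDeriv d u' v e := fun φ hφ hc => by
  rw [← h φ hφ hc]
  exact integral_congr_ae (hu.mono fun z hz => by simp only [hz])

lemma IsWeakDeriv2.congr {u u' w w' : SpT d → ℝ} {e₁ e₂ : SpT d}
    (h : IsWeakDeriv2 d u w e₁ e₂) (hu : u =ᵐ[volume] u') (hw : w =ᵐ[volume] w') :
    IsWeakDeriv2 d u' w' e₁ e₂ := fun φ hφ hc => by
  rw [← integral_congr_ae (hw.mono fun z hz => show w z * φ z = w' z * φ z by rw [hz]),
    ← h φ hφ hc]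
  exact integral_congr_ae (hu.mono fun z hz => by simp only [hz])

lemma IsWeakDeriv.smul {u v : SpT d → ℝ} {e : SpT d} (h : IsWeakDeriv d u v e) (c : ℝ) :
    IsWeakDeriv d u (fun z => c * v z) (c • e) := fun φ hφ hc => by
  simp only [map_smul, smul_eq_mul, mul_assoc, mul_left_comm _ c, integral_const_mul, h φ hφ hc,
    mul_neg]

lemma IsWeakDeriv2.smul {u w : SpT d → ℝ} {e : SpT d} (h : IsWeakDeriv2 d u w e e) (c : ℝ) :
    IsWeakDeriv2 d u (fun z => c ^ 2 * w z) (c • e) (c • e) := fun φ hφ hc => by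
  have hD : ContDiff ℝ (⊤ : ℕ∞) (fun w => fderiv ℝ φ w e) :=
    (hφ.fderiv_right (m := (⊤ : ℕ∞)) (by simp)).clm_apply contDiff_const
  have : ∀ z, fderiv ℝ (fun w => fderiv ℝ φ w (c • e)) z (c • e) =
      c ^ 2 * fderiv ℝ (fun w => fderiv ℝ φ w e) z e := fun z => by
    simp only [map_smul, smul_eq_mul]
    rw [fderiv_const_mul ((hD.differentiable (by simp)) z)]
    simp only [smul_apply, smul_eq_mul]
    ring
  simp only [this, mul_assoc, mul_left_comm _ (c ^ 2), integral_const_mul, h φ hφ hc]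

/-- A first weak derivative is a difference of translates up to an averaged second derivative. -/
lemma IsWeakDeriv.ae_eq_translate_sub {u v w : SpT d → ℝ} {y : SpT d} (hv : IsWeakDeriv d u v y)
    (hw : IsWeakDeriv2 d u w y y) (hum : Measurable u) (hwm : Measurable w)
    (hul : LocallyIntegrable u volume) (hvl : LocallyIntegrable v volume)
    (hwl : LocallyIntegrable w volume) (hul' : LocallyIntegrable (fun z => u (z + y)) volume)
    (hJ : LocallyIntegrable (fun z => ∫ s in (0 : ℝ)..1, (1 - s) * w (z + s • y)) volume) :
    ∀ᵐ z, v z = u (z + y) - u z - ∫ s in (0 : ℝ)..1, (1 - s) * w (z + s • y) := by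
  have : (volume : Measure (SpT d)).IsAddRightInvariant := by
    rw [Measure.volume_eq_prod]
    infer_instance
  refine ae_eq_of_integral_contDiff_smul_eq hvl ((hul'.sub hul).sub hJ) fun φ hφ hc => ?_
  have hD : ContDiff ℝ (⊤ : ℕ∞) (fun w => fderiv ℝ φ w y) :=
    (hφ.fderiv_right (m := (⊤ : ℕ∞)) (by simp)).clm_apply contDiff_const
  have hD2 : ContDiff ℝ (⊤ : ℕ∞) (fun w => fderiv ℝ (fun w => fderiv ℝ φ w y) w y) :=
    (hD.fderiv_right (m := (⊤ : ℕ∞)) (by simp)).clm_apply contDiff_const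
  have hDc : HasCompactSupport (fun w => fderiv ℝ φ w y) := hc.fderiv_apply ℝ y
  have hD2c : HasCompactSupport (fun w => fderiv ℝ (fun w => fderiv ℝ φ w y) w y) :=
    hDc.fderiv_apply ℝ y
  have hφy : HasCompactSupport fun z => φ (z - y) := hc.comp_homeomorph (Homeomorph.subRight y)
  have hint : ∀ {f ψ : SpT d → ℝ}, LocallyIntegrable f volume → Continuous ψ →
      HasCompactSupport ψ → Integrable (fun z => f z * ψ z) := fun hf hψ hψc => by
    simpa only [smul_eq_mul, mul_comm] using
      hf.integrable_smul_left_of_hasCompactSupport hψ hψc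
  have hrem : ∫ z, (∫ s in (0 : ℝ)..1, (1 - s) * w (z + s • y)) * φ z =
      ∫ z, u z * (φ (z - y) - φ z + fderiv ℝ φ z y) := by
    rw [integral_translate_average_mul hwm hwl hφ.continuous hc y]
    have : ∀ s : ℝ, ∫ z, w z * φ (z - s • y) =
        ∫ z, u z * fderiv ℝ (fun w => fderiv ℝ φ w y) (z - s • y) y := fun s => by
      rw [← hw (fun z => φ (z - s • y)) (hφ.comp (contDiff_id.sub contDiff_const))
        (hc.comp_homeomorph (Homeomorph.subRight (s • y)))]
      simp only [fderiv_comp_sub_const]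
      simp only [fderiv_comp_sub_const (fun w => fderiv ℝ φ w y)]
    simp only [this]
    rw [integral_one_sub_mul_integral_translate hum hul hD2.continuous hD2c y]
    simp only [integral_one_sub_mul_fderiv_fderiv hφ]
  have htr : ∫ z, u (z + y) * φ z = ∫ z, u z * φ (z - y) := by
    rw [← integral_add_right_eq_self (fun z => u z * φ (z - y)) y]
    simp
  have hv' := hv φ hφ hc
  have e1 : ∫ z, u z * (φ (z - y) - φ z + fderiv ℝ φ z y) =
      (∫ z, u z * φ (z - y)) - (∫ z, u z * φ z) + ∫ z, u z * fderiv ℝ φ z y := by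
    have i1 : Integrable fun z => u z * φ (z - y) :=
      hint hul (hφ.continuous.comp (continuous_id.sub continuous_const)) hφy
    have i2 := hint hul hφ.continuous hc
    have i3 : Integrable fun z => u z * φ (z - y) - u z * φ z := i1.sub i2
    rw [← integral_sub i1 i2, ← integral_add i3 (hint hul hD.continuous hDc)]
    refine integral_congr_ae (ae_of_all _ fun z => ?_)
    simp only
    ring
  have e2 : ∫ z, φ z • (u (z + y) - u z - ∫ s in (0 : ℝ)..1, (1 - s) * w (z + s • y)) =
      (∫ z, u (z + y) * φ z) - (∫ z, u z * φ z) -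
        ∫ z, (∫ s in (0 : ℝ)..1, (1 - s) * w (z + s • y)) * φ z := by
    have i1 := hint hul' hφ.continuous hc
    have i2 := hint hul hφ.continuous hc
    have i3 : Integrable fun z => u (z + y) * φ z - u z * φ z := i1.sub i2
    rw [← integral_sub i1 i2, ← integral_sub i3 (hint hJ hφ.continuous hc)]
    refine integral_congr_ae (ae_of_all _ fun z => ?_)
    simp only [smul_eq_mul]
    ring
  have e3 : ∫ z, φ z • v z = ∫ z, v z * φ z := by simp only [smul_eq_mul, mul_comm]
  rw [e2, hrem, htr, e1, e3]
  linarith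

end WeakDerivatives

section Interpolation

variable {d : ℕ} {p q β : ℝ}

lemma measurable_ofReal_abs {f : SpT d → ℝ} (hf : Measurable f) :
    Measurable fun z => ENNReal.ofReal |f z| := hf.abs.ennreal_ofReal

lemma morreyNorm_translate_le (y : Spc d) (f : SpT d → ℝ) :
    morreyNorm d p q β (fun z => f (z + (0, y))) ≤ morreyNorm d p q β f := by
  simp only [morreyNorm_eq]
  exact morreyNormENN_translate_le y fun z => ENNReal.ofReal |f z|

lemma morreyNorm_const_mul_le (hp : 1 < p) (hq : 1 < q) (c : ℝ) {f : SpT d → ℝ}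
    (hf : AEStronglyMeasurable f volume) :
    morreyNorm d p q β (fun z => c * f z) ≤ ENNReal.ofReal |c| * morreyNorm d p q β f := by
  have hp0 := one_pos.trans hp
  have hq0 := one_pos.trans hq
  rw [morreyNorm_congr hp0 hq0 hf.ae_eq_mk,
    morreyNorm_congr (f := fun z => c * f z) hp0 hq0 (hf.ae_eq_mk.fun_comp (c * ·)),
    morreyNorm_eq, morreyNorm_eq]
  simp only [Function.comp_apply, abs_mul, ENNReal.ofReal_mul (abs_nonneg c)]
  exact morreyNormENN_const_mul_le hp hq _
    (measurable_ofReal_abs hf.stronglyMeasurable_mk.measurable)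

lemma measurable_uncurry_translate {F : Type*} [MeasurableSpace F] {f : SpT d → F}
    (hf : Measurable f) (y : SpT d) :
    Measurable (Function.uncurry fun (s : ℝ) (z : SpT d) => f (z + s • y)) :=
  hf.comp (f := fun a : ℝ × SpT d => a.2 + a.1 • y) (by fun_prop)

lemma morreyNormENN_translate_average_le (hp : 1 < p) (hq : 1 < q) {G : SpT d → ℝ≥0∞}
    (hG : Measurable G) (y : Spc d) :
    morreyNormENN d p q β (fun z => ∫⁻ s in Set.Ioc (0 : ℝ) 1, G (z + s • ((0, y) : SpT d))) ≤
      morreyNormENN d p q β G := by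
  refine (morreyNormENN_lintegral_le (volume.restrict (Set.Ioc (0 : ℝ) 1)) hp hq
    (measurable_uncurry_translate hG (0, y))).trans ?_
  calc _ ≤ ∫⁻ _ in Set.Ioc (0 : ℝ) 1, morreyNormENN d p q β G := by
        refine lintegral_mono fun s => ?_
        simpa only [Prod.smul_mk, smul_zero] using morreyNormENN_translate_le (s • y) G
    _ = _ := by simp

lemma ofReal_abs_integral_one_sub_mul_le (g : ℝ → ℝ) :
    ENNReal.ofReal |∫ s in (0 : ℝ)..1, (1 - s) * g s| ≤
      ∫⁻ s in Set.Ioc (0 : ℝ) 1, ENNReal.ofReal |g s| := by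
  rw [intervalIntegral.integral_of_le zero_le_one, ← Real.norm_eq_abs, ofReal_norm]
  refine (enorm_integral_le_lintegral_enorm _).trans ?_
  refine setLIntegral_mono' measurableSet_Ioc fun s hs => ?_
  rw [← ofReal_norm, Real.norm_eq_abs, abs_mul]
  refine ENNReal.ofReal_le_ofReal (mul_le_of_le_one_left (abs_nonneg _) ?_)
  exact abs_le.2 ⟨by linarith [hs.2], by linarith [hs.1]⟩

lemma morreyNorm_weakDeriv_le_of_measurable (hp : 1 < p) (hq : 1 < q) {u v w : SpT d → ℝ}
    {y : Spc d} (hv : IsWeakDeriv d u v (0, y)) (hw : IsWeakDeriv2 d u w (0, y) (0, y))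
    (hum : Measurable u) (hwm : Measurable w) (hu : morreyNorm d p q β u ≠ ⊤)
    (hvE : MemE d p q β v) (hwE : morreyNorm d p q β w ≠ ⊤) :
    morreyNorm d p q β v ≤ 2 * morreyNorm d p q β u + morreyNorm d p q β w := by
  have hp0 := one_pos.trans hp
  have hq0 := one_pos.trans hq
  have hum' : Measurable fun z => u (z + (0, y)) := hum.comp (measurable_add_const _)
  have havg := morreyNormENN_translate_average_le (β := β) hp hq (measurable_ofReal_abs hwm) y
  rw [← morreyNorm_eq] at havg
  have hJm : StronglyMeasurable fun z : SpT d =>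
      ∫ s in (0 : ℝ)..1, (1 - s) * w (z + s • ((0, y) : SpT d)) := by
    simp only [intervalIntegral.integral_of_le zero_le_one]
    have h := (((measurable_const (a := (1 : ℝ))).sub measurable_fst).mul
      (measurable_uncurry_translate hwm (0, y))).stronglyMeasurable
    exact StronglyMeasurable.integral_prod_left' (μ := volume.restrict (Set.Ioc (0 : ℝ) 1)) h
  have hJ : morreyNorm d p q β (fun z : SpT d =>
      ∫ s in (0 : ℝ)..1, (1 - s) * w (z + s • ((0, y) : SpT d))) ≠ ⊤ := by
    refine ne_top_of_le_ne_top hwE (le_trans ?_ havg)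
    rw [morreyNorm_eq]
    exact morreyNormENN_mono hp0 hq0
      (ae_of_all _ fun z => ofReal_abs_integral_one_sub_mul_le _)
  have hae := hv.ae_eq_translate_sub hw hum hwm
    (locallyIntegrable_of_morreyNorm hp hq hum.aestronglyMeasurable hu)
    (locallyIntegrable_of_morreyNorm hp hq hvE.1 hvE.2)
    (locallyIntegrable_of_morreyNorm hp hq hwm.aestronglyMeasurable hwE)
    (locallyIntegrable_of_morreyNorm hp hq hum'.aestronglyMeasurable
      (ne_top_of_le_ne_top hu (morreyNorm_translate_le y u)))
    (locallyIntegrable_of_morreyNorm hp hq hJm.aestronglyMeasurable hJ)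
  calc morreyNorm d p q β v
      ≤ morreyNormENN d p q β (fun z =>
          (ENNReal.ofReal |u (z + (0, y))| + ENNReal.ofReal |u z|) +
            ∫⁻ s in Set.Ioc (0 : ℝ) 1, ENNReal.ofReal |w (z + s • ((0, y) : SpT d))|) := by
        rw [morreyNorm_eq]
        refine morreyNormENN_mono hp0 hq0 ?_
        filter_upwards [hae] with z hz
        rw [hz]
        refine le_trans ?_ (add_le_add le_rfl (ofReal_abs_integral_one_sub_mul_le _))
        rw [← ENNReal.ofReal_add (abs_nonneg _) (abs_nonneg _),
          ← ENNReal.ofReal_add (by positivity) (abs_nonneg _)]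
        exact ENNReal.ofReal_le_ofReal ((abs_sub _ _).trans (by gcongr; exact abs_sub _ _))
    _ ≤ (morreyNorm d p q β (fun z => u (z + (0, y))) + morreyNorm d p q β u) +
          morreyNorm d p q β w := by
        refine (morreyNormENN_add_le hp hq ((measurable_ofReal_abs hum').add
          (measurable_ofReal_abs hum)) ?_).trans (add_le_add ?_ havg)
        · exact (measurable_uncurry_translate (measurable_ofReal_abs hwm) (0, y)).lintegral_prod_left'
        · rw [morreyNorm_eq, morreyNorm_eq]
          exact morreyNormENN_add_le hp hq (measurable_ofReal_abs hum') (measurable_ofReal_abs hum)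
    _ ≤ 2 * morreyNorm d p q β u + morreyNorm d p q β w := by
        rw [two_mul]
        gcongr
        exact morreyNorm_translate_le y u

lemma morreyNorm_weakDeriv_le (hp : 1 < p) (hq : 1 < q) {u v w : SpT d → ℝ}
    {y : Spc d} (hv : IsWeakDeriv d u v (0, y)) (hw : IsWeakDeriv2 d u w (0, y) (0, y))
    (huE : MemE d p q β u) (hvE : MemE d p q β v) (hwE : MemE d p q β w) :
    morreyNorm d p q β v ≤ 2 * morreyNorm d p q β u + morreyNorm d p q β w := by
  have hu := huE.1.ae_eq_mk
  have hw' := hwE.1.ae_eq_mk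
  have hcu := morreyNorm_congr (β := β) (one_pos.trans hp) (one_pos.trans hq) hu
  have hcw := morreyNorm_congr (β := β) (one_pos.trans hp) (one_pos.trans hq) hw'
  rw [hcu, hcw]
  exact morreyNorm_weakDeriv_le_of_measurable hp hq (hv.congr hu) (hw.congr hu hw')
    huE.1.stronglyMeasurable_mk.measurable hwE.1.stronglyMeasurable_mk.measurable
    (hcu ▸ huE.2) hvE (hcw ▸ hwE.2)

lemma MemE.const_mul (hp : 1 < p) (hq : 1 < q) {f : SpT d → ℝ} (hf : MemE d p q β f) (c : ℝ) :
    MemE d p q β (fun z => c * f z) :=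
  ⟨hf.1.const_mul c, ne_top_of_le_ne_top (ENNReal.mul_ne_top ENNReal.ofReal_ne_top hf.2)
    (morreyNorm_const_mul_le hp hq c hf.1)⟩

/-- Interpolation at scale `h` for the derivative in a spatial direction. -/
lemma morreyNorm_weakDeriv_le_scaled (hp : 1 < p) (hq : 1 < q) {u v w : SpT d → ℝ}
    {y : Spc d} (hv : IsWeakDeriv d u v (0, y)) (hw : IsWeakDeriv2 d u w (0, y) (0, y))
    (huE : MemE d p q β u) (hvE : MemE d p q β v) (hwE : MemE d p q β w) {h : ℝ} (hh : 0 < h) :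
    morreyNorm d p q β v ≤
      ENNReal.ofReal (2 * h⁻¹) * morreyNorm d p q β u + ENNReal.ofReal h * morreyNorm d p q β w := by
  have hv' := hv.smul h
  have hw' := hw.smul h
  simp only [Prod.smul_mk, smul_zero] at hv' hw'
  have key := morreyNorm_weakDeriv_le hp hq hv' hw' huE (hvE.const_mul hp hq h)
    (hwE.const_mul hp hq (h ^ 2))
  have hcancel : (fun z => h⁻¹ * (h * v z)) = v := by
    funext z
    field_simp
  calc morreyNorm d p q β v = morreyNorm d p q β (fun z => h⁻¹ * (h * v z)) := by rw [hcancel]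
    _ ≤ ENNReal.ofReal h⁻¹ * morreyNorm d p q β (fun z => h * v z) := by
        have := morreyNorm_const_mul_le (β := β) hp hq h⁻¹ (hvE.1.const_mul h)
        rwa [abs_of_pos (inv_pos.2 hh)] at this
    _ ≤ ENNReal.ofReal h⁻¹ *
        (2 * morreyNorm d p q β u + ENNReal.ofReal (h ^ 2) * morreyNorm d p q β w) := by
        gcongr
        refine key.trans (add_le_add le_rfl ?_)
        have := morreyNorm_const_mul_le (β := β) hp hq (h ^ 2) hwE.1
        rwa [abs_of_pos (by positivity)] at this
    _ = _ := by
        rw [mul_add, ← mul_assoc, ← mul_assoc, ← ENNReal.ofReal_mul (inv_nonneg.2 hh.le),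
          ENNReal.ofReal_mul zero_le_two, ENNReal.ofReal_ofNat, mul_comm (ENNReal.ofReal h⁻¹) 2]
        congr 3
        field_simp

lemma morreyNorm_gradMag_le (hp : 1 < p) (hq : 1 < q) {Du : Fin d → SpT d → ℝ}
    (hDu : ∀ i, AEStronglyMeasurable (Du i) volume) :
    morreyNorm d p q β (gradMag d Du) ≤ ∑ i, morreyNorm d p q β (Du i) := by
  have hp0 := one_pos.trans hp
  have hq0 := one_pos.trans hq
  calc morreyNorm d p q β (gradMag d Du)
      ≤ morreyNormENN d p q β (fun z => ∑ i, ENNReal.ofReal |(hDu i).mk (Du i) z|) := by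
        rw [morreyNorm_eq]
        refine morreyNormENN_mono hp0 hq0 ?_
        filter_upwards [ae_all_iff.2 fun i => (hDu i).ae_eq_mk] with z hz
        simp only [← hz]
        rw [← ENNReal.ofReal_sum_of_nonneg fun i _ => abs_nonneg _]
        refine ENNReal.ofReal_le_ofReal ?_
        rw [gradMag, abs_of_nonneg (Real.sqrt_nonneg _)]
        refine Real.sqrt_le_iff.2 ⟨Finset.sum_nonneg fun i _ => abs_nonneg _, ?_⟩
        simpa only [sq_abs] using
          Finset.sum_sq_le_sq_sum_of_nonneg (s := Finset.univ) fun i _ => abs_nonneg (Du i z)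
    _ ≤ ∑ i, morreyNormENN d p q β (fun z => ENNReal.ofReal |(hDu i).mk (Du i) z|) :=
        morreyNormENN_sum_le hp hq fun i =>
          measurable_ofReal_abs (hDu i).stronglyMeasurable_mk.measurable
    _ = _ := Finset.sum_congr rfl fun i _ => by
        rw [morreyNorm_congr hp0 hq0 (hDu i).ae_eq_mk, morreyNorm_eq]

lemma morreyNorm_le_hessMag (hp : 0 < p) (hq : 0 < q) (D2u : Fin d → Fin d → SpT d → ℝ)
    (i j : Fin d) : morreyNorm d p q β (D2u i j) ≤ morreyNorm d p q β (hessMag d D2u) := by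
  rw [morreyNorm_eq, morreyNorm_eq]
  refine morreyNormENN_mono hp hq (ae_of_all _ fun z => ENNReal.ofReal_le_ofReal ?_)
  rw [hessMag, abs_of_nonneg (Real.sqrt_nonneg _)]
  refine Real.abs_le_sqrt ?_
  calc (D2u i j z) ^ 2 ≤ ∑ j, (D2u i j z) ^ 2 :=
        Finset.single_le_sum (f := fun j => (D2u i j z) ^ 2) (fun _ _ => sq_nonneg _)
          (Finset.mem_univ j)
    _ ≤ _ := Finset.single_le_sum (f := fun i => ∑ j, (D2u i j z) ^ 2)
        (fun _ _ => Finset.sum_nonneg fun _ _ => sq_nonneg _) (Finset.mem_univ i)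

end Interpolation

/-- Lemma 3.27.4, interpolation: for `u ∈ E^{1,2}_{p,q,β}` and
    `ε ∈ (0,1]`,
    `‖Du‖_{E_{p,q,β}} ≤ ε(‖∂ₜu‖ + ‖D²u‖)_{E_{p,q,β}} + N ε⁻¹ ‖u‖_{E_{p,q,β}}`. -/
theorem statement7 (d : ℕ) (hd : 1 ≤ d) (p q β : ℝ)
    (hp : 1 < p) (hq : 1 < q) (hβ0 : 0 < β) (hβ : β ≤ (d : ℝ) / p + 2 / q) :
    ∃ N : ℝ≥0, ∀ (u : SpT d → ℝ) (Du : Fin d → SpT d → ℝ)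
      (D2u : Fin d → Fin d → SpT d → ℝ) (ut : SpT d → ℝ),
      Mem12 d p q β u Du D2u ut →
      ∀ ε : ℝ, 0 < ε → ε ≤ 1 →
        morreyNorm d p q β (gradMag d Du) ≤
          ENNReal.ofReal ε *
              (morreyNorm d p q β ut + morreyNorm d p q β (hessMag d D2u))
            + N * ENNReal.ofReal ε⁻¹ * morreyNorm d p q β u := by
  have hp0 := one_pos.trans hp
  have hq0 := one_pos.trans hq
  have hd0 : (0 : ℝ) < d := by exact_mod_cast hd
  refine ⟨2 * (d : ℝ≥0) ^ 2, fun u Du D2u ut hmem ε hε _ => ?_⟩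
  obtain ⟨hu, hD, hD2, -, hDE, hD2E, -⟩ := hmem
  set U := morreyNorm d p q β u
  set H := morreyNorm d p q β (hessMag d D2u)
  have hi : ∀ i, morreyNorm d p q β (Du i) ≤
      ENNReal.ofReal (2 * (ε / d)⁻¹) * U + ENNReal.ofReal (ε / d) * H := fun i =>
    (morreyNorm_weakDeriv_le_scaled hp hq (hD i) (hD2 i i) hu (hDE i) (hD2E i i)
      (div_pos hε hd0)).trans (by gcongr; exact morreyNorm_le_hessMag hp0 hq0 D2u i i)
  have hcast : (d : ℝ≥0∞) = ENNReal.ofReal d := (ENNReal.ofReal_natCast d).symm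
  have hN : ((2 * (d : ℝ≥0) ^ 2 : ℝ≥0) : ℝ≥0∞) = ENNReal.ofReal (2 * (d : ℝ) ^ 2) := by
    rw [ENNReal.ofReal_mul zero_le_two, ENNReal.ofReal_pow hd0.le]
    simp
  calc morreyNorm d p q β (gradMag d Du)
      ≤ ∑ i, morreyNorm d p q β (Du i) := morreyNorm_gradMag_le hp hq fun i => (hDE i).1
    _ ≤ ∑ _i : Fin d, (ENNReal.ofReal (2 * (ε / d)⁻¹) * U + ENNReal.ofReal (ε / d) * H) :=
        Finset.sum_le_sum fun i _ => hi i
    _ = ENNReal.ofReal ε * H + ENNReal.ofReal (2 * (d : ℝ) ^ 2) * ENNReal.ofReal ε⁻¹ * U := by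
        rw [Finset.sum_const, Finset.card_univ, Fintype.card_fin, nsmul_eq_mul, hcast, mul_add,
          ← mul_assoc, ← mul_assoc, ← ENNReal.ofReal_mul hd0.le, ← ENNReal.ofReal_mul hd0.le,
          ← ENNReal.ofReal_mul (by positivity), add_comm]
        congr 3
        · field_simp
        · field_simp
    _ ≤ _ := by
        rw [hN]
        gcongr
        exact le_add_self
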